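/- Let S ⊆ ℕ and let f : ℕ × ℕ → ℝ. Suppose that for every A > 0 there is a constant C_A such that |S(x;q,a) − f(q, gcd(q,a)) x| ≤ C_A x (log x)^{−A} for all real x ≥ 2 and all integers q ≥ 1, 1 ≤ a ≤ q. Then for every A > 0 there is a constant C'_A such that for all real x ≥ 2 and all real Q with 1 ≤ Q ≤ x, Σ_{q ≤ Q} Σ_{a=1}^{q} |S(x;q,a) − f(q, gcd(q,a)) x|² ≤ C'_A (Q x + x² (log x)^{−A}). -/

import Mathlib

open Classical Finset

/-- `S(x;q,a) = #{s ∈ S : s ≤ x, s ≡ a (mod q)}`. -/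
noncomputable def Scount (S : Set ℕ) (x : ℝ) (q a : ℕ) : ℝ :=
  ((Finset.Icc 1 ⌊x⌋₊).filter (fun n => n % q = a % q ∧ n ∈ S)).card

/-- The squared modulus `|∑_{n ≤ N} c n e(n t)|²`, written with real trigonometric sums. -/
noncomputable def trigSq (c : ℕ → ℝ) (N : ℕ) (t : ℝ) : ℝ :=
  (∑ n ∈ Icc 1 N, c n * Real.cos (2 * Real.pi * n * t)) ^ 2 +
    (∑ n ∈ Icc 1 N, c n * Real.sin (2 * Real.pi * n * t)) ^ 2

theorem trigSq_nonneg (c : ℕ → ℝ) (N : ℕ) (t : ℝ) : 0 ≤ trigSq c N t := by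
  unfold trigSq; positivity

theorem trigSq_eq_sum_sum (c : ℕ → ℝ) (N : ℕ) (t : ℝ) :
    trigSq c N t = ∑ m ∈ Icc 1 N, ∑ n ∈ Icc 1 N,
      c m * c n * Real.cos (2 * Real.pi * ((m : ℝ) - n) * t) := by
  unfold trigSq
  rw [sq, sq, sum_mul_sum, sum_mul_sum, ← sum_add_distrib]
  refine sum_congr rfl fun m _ => ?_
  rw [← sum_add_distrib]
  refine sum_congr rfl fun n _ => ?_
  rw [show 2 * Real.pi * ((m : ℝ) - n) * t = 2 * Real.pi * m * t - 2 * Real.pi * n * t by ring,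
    Real.cos_sub]
  ring

theorem continuous_trigSq (c : ℕ → ℝ) (N : ℕ) : Continuous (trigSq c N) := by
  unfold trigSq; fun_prop

theorem integral_cos_two_pi_int_mul {k : ℤ} (hk : k ≠ 0) :
    ∫ t in (0 : ℝ)..2, Real.cos (2 * Real.pi * k * t) = 0 := by
  have hne : 2 * Real.pi * (k : ℝ) ≠ 0 := by
    have : (k : ℝ) ≠ 0 := by exact_mod_cast hk
    positivity
  rw [intervalIntegral.integral_comp_mul_left (fun t => Real.cos t) hne, integral_cos]
  have : Real.sin (2 * Real.pi * k * 2) = 0 := by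
    rw [show 2 * Real.pi * (k : ℝ) * 2 = ((4 * k : ℤ) : ℝ) * Real.pi by push_cast; ring]
    exact Real.sin_int_mul_pi _
  simp [this]

theorem integral_trigSq (c : ℕ → ℝ) (N : ℕ) :
    ∫ t in (0 : ℝ)..2, trigSq c N t = 2 * ∑ n ∈ Icc 1 N, c n ^ 2 := by
  simp only [trigSq_eq_sum_sum]
  rw [intervalIntegral.integral_finsetSum
    (fun m _ => Continuous.intervalIntegrable (by fun_prop) _ _), mul_sum]
  refine sum_congr rfl fun m hm => ?_
  rw [intervalIntegral.integral_finsetSum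
    (fun n _ => Continuous.intervalIntegrable (by fun_prop) _ _), sum_eq_single m]
  · simp; ring
  · intro n _ hn
    have hk : (m : ℤ) - n ≠ 0 := by
      intro h; apply hn; omega
    have := integral_cos_two_pi_int_mul hk
    push_cast at this
    rw [intervalIntegral.integral_const_mul, this, mul_zero]
  · intro h; exact absurd hm h

theorem mul_apply_le_integral_add {g g' p : ℝ → ℝ} {a δ : ℝ} (hδ : 0 ≤ δ)
    (hg : ∀ t, HasDerivAt g (g' t) t) (hg' : Continuous g') (hp : Continuous p)
    (hgp : ∀ t, |g' t| ≤ p t) :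
    δ * g a ≤ ∫ t in a..a + δ, (g t + δ * p t) := by
  have hgc : Continuous g := continuous_iff_continuousAt.2 fun t => (hg t).continuousAt
  have hH : ∀ t, HasDerivAt (fun t => (t - (a + δ)) * g t) (g t + (t - (a + δ)) * g' t) t := by
    intro t
    have := ((hasDerivAt_id t).sub_const (a + δ)).fun_mul (hg t)
    exact this.congr_deriv (by simp)
  have h := intervalIntegral.integral_eq_sub_of_hasDerivAt (a := a) (b := a + δ)
    (fun t _ => hH t) (Continuous.intervalIntegrable (by fun_prop) _ _)
  have e : δ * g a = ∫ t in a..a + δ, (g t + (t - (a + δ)) * g' t) := by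
    rw [h]; ring
  rw [e]
  refine intervalIntegral.integral_mono_on (by linarith)
    (Continuous.intervalIntegrable (by fun_prop) _ _)
    (Continuous.intervalIntegrable (by fun_prop) _ _) fun t ht => ?_
  have h1 : |(t - (a + δ)) * g' t| ≤ δ * p t := by
    rw [abs_mul]
    refine mul_le_mul ?_ (hgp t) (abs_nonneg _) hδ
    rw [abs_le]; constructor <;> linarith [ht.1, ht.2]
  linarith [le_abs_self ((t - (a + δ)) * g' t)]

theorem exists_hasDerivAt_trigSq (c : ℕ → ℝ) (N : ℕ) {M : ℝ} (hM : 0 < M) :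
    ∃ g' : ℝ → ℝ, Continuous g' ∧ (∀ t, HasDerivAt (trigSq c N) (g' t) t) ∧
      ∀ t, |g' t| ≤ M * trigSq c N t + trigSq (fun n => 2 * Real.pi * n * c n) N t / M := by
  set C : ℝ → ℝ := fun t => ∑ n ∈ Icc 1 N, c n * Real.cos (2 * Real.pi * n * t) with hC
  set D : ℝ → ℝ := fun t => ∑ n ∈ Icc 1 N, c n * Real.sin (2 * Real.pi * n * t) with hD
  set C' : ℝ → ℝ := fun t =>
    ∑ n ∈ Icc 1 N, 2 * Real.pi * n * c n * Real.sin (2 * Real.pi * n * t) with hC'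
  set D' : ℝ → ℝ := fun t =>
    ∑ n ∈ Icc 1 N, 2 * Real.pi * n * c n * Real.cos (2 * Real.pi * n * t) with hD'
  have dC : ∀ t, HasDerivAt C (-C' t) t := by
    intro t
    simp only [hC, hC', ← sum_neg_distrib]
    refine HasDerivAt.fun_sum fun n _ => ?_
    have := ((((hasDerivAt_id' t).const_mul (2 * Real.pi * n)).cos).const_mul (c n))
    exact this.congr_deriv (by ring)
  have dD : ∀ t, HasDerivAt D (D' t) t := by
    intro t
    simp only [hD, hD']
    refine HasDerivAt.fun_sum fun n _ => ?_
    have := ((((hasDerivAt_id' t).const_mul (2 * Real.pi * n)).sin).const_mul (c n))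
    exact this.congr_deriv (by ring)
  refine ⟨fun t => 2 * C t * (-C' t) + 2 * D t * D' t, ?_, ?_, ?_⟩
  · simp only [hC, hD, hC', hD']; fun_prop
  · intro t
    have := ((dC t).fun_pow 2).fun_add ((dD t).fun_pow 2)
    exact this.congr_deriv (by ring)
  · intro t
    have e1 : trigSq c N t = C t ^ 2 + D t ^ 2 := rfl
    have e2 : trigSq (fun n => 2 * Real.pi * n * c n) N t = D' t ^ 2 + C' t ^ 2 := rfl
    rw [e1, e2]
    have key : ∀ u v : ℝ, 2 * u * v ≤ M * u ^ 2 + v ^ 2 / M := by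
      intro u v
      have : M * u ^ 2 + v ^ 2 / M - 2 * u * v = (M * u - v) ^ 2 / M := by field_simp; ring
      have h2 : 0 ≤ (M * u - v) ^ 2 / M := by positivity
      linarith
    have k1 := key (C t) (C' t)
    have k2 := key (D t) (D' t)
    have k3 := key (C t) (-C' t)
    have k4 := key (D t) (-D' t)
    rw [neg_sq] at k3 k4
    rw [add_div, abs_le]
    constructor <;> nlinarith

/-- The large sieve inequality for `δ`-separated points of `[0, 1]`. -/
theorem large_sieve {ι : Type*} (P : Finset ι) (α : ι → ℝ) {δ : ℝ} (hδ : 0 < δ) (hδ1 : δ ≤ 1)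
    (h0 : ∀ i ∈ P, 0 ≤ α i) (h1 : ∀ i ∈ P, α i ≤ 1)
    (hsep : ∀ i ∈ P, ∀ j ∈ P, i ≠ j → δ ≤ |α i - α j|) (c : ℕ → ℝ) {N : ℕ} (hN : 1 ≤ N) :
    ∑ i ∈ P, trigSq c N (α i) ≤ 100 * (1 / δ + N) * ∑ n ∈ Icc 1 N, c n ^ 2 := by
  have hN0 : (0 : ℝ) < N := by exact_mod_cast hN
  obtain ⟨g', hg'c, hg', hb⟩ := exists_hasDerivAt_trigSq c N hN0
  set d : ℕ → ℝ := fun n => 2 * Real.pi * n * c n with hd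
  set p : ℝ → ℝ := fun t => N * trigSq c N t + trigSq d N t / N with hp
  have hcc := continuous_trigSq c N
  have hdc := continuous_trigSq d N
  have hpc : Continuous p := by simp only [hp]; fun_prop
  set F : ℝ → ℝ := fun t => trigSq c N t + δ * p t with hF
  have hFc : Continuous F := by simp only [hF]; fun_prop
  have hF0 : ∀ t, 0 ≤ F t := by
    intro t
    have := trigSq_nonneg c N t
    have := trigSq_nonneg d N t
    simp only [hF, hp]; positivity
  have h_local : δ * ∑ i ∈ P, trigSq c N (α i) ≤ ∑ i ∈ P, ∫ t in Set.Ioc (α i) (α i + δ), F t := by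
    rw [mul_sum]
    refine sum_le_sum fun i _ => ?_
    rw [← intervalIntegral.integral_of_le (by linarith)]
    exact mul_apply_le_integral_add hδ.le hg' hg'c hpc hb
  have h_union : ∑ i ∈ P, ∫ t in Set.Ioc (α i) (α i + δ), F t
      = ∫ t in ⋃ i ∈ P, Set.Ioc (α i) (α i + δ), F t := by
    rw [MeasureTheory.integral_biUnion_finset]
    · exact fun i _ => measurableSet_Ioc
    · intro i hi j hj hij
      refine Set.disjoint_left.2 fun t ht ht' => ?_
      have := hsep i hi j hj hij
      rcases le_abs.1 this with h | h <;> linarith [ht.1, ht.2, ht'.1, ht'.2]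
    · intro i _
      exact (hFc.integrableOn_Icc).mono_set Set.Ioc_subset_Icc_self
  have h_mono : ∫ t in ⋃ i ∈ P, Set.Ioc (α i) (α i + δ), F t ≤ ∫ t in Set.Ioc 0 2, F t := by
    refine MeasureTheory.setIntegral_mono_set
      ((hFc.integrableOn_Icc).mono_set Set.Ioc_subset_Icc_self)
      (Filter.Eventually.of_forall hF0) (Filter.Eventually.of_forall ?_)
    refine Set.iUnion₂_subset fun i hi t ht => ⟨?_, ?_⟩
    · linarith [ht.1, h0 i hi]
    · linarith [ht.2, h1 i hi]
  have h_int : ∫ t in Set.Ioc (0 : ℝ) 2, F t = (1 + δ * N) * (2 * ∑ n ∈ Icc 1 N, c n ^ 2)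
      + δ / N * (2 * ∑ n ∈ Icc 1 N, d n ^ 2) := by
    rw [← intervalIntegral.integral_of_le (by norm_num), ← integral_trigSq, ← integral_trigSq,
      ← intervalIntegral.integral_const_mul, ← intervalIntegral.integral_const_mul,
      ← intervalIntegral.integral_add (Continuous.intervalIntegrable (by fun_prop) _ _)
        (Continuous.intervalIntegrable (by fun_prop) _ _)]
    refine intervalIntegral.integral_congr fun t _ => ?_
    simp only [hF, hp]; ring
  have h_deriv : ∑ n ∈ Icc 1 N, d n ^ 2 ≤ 40 * N ^ 2 * ∑ n ∈ Icc 1 N, c n ^ 2 := by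
    rw [mul_sum]
    refine sum_le_sum fun n hn => ?_
    have hn' : (n : ℝ) ≤ N := by exact_mod_cast (mem_Icc.1 hn).2
    have hpi : Real.pi ^ 2 ≤ 10 := by nlinarith [Real.pi_lt_d2, Real.pi_pos]
    have hnn : (n : ℝ) ^ 2 ≤ N ^ 2 := by gcongr
    have : Real.pi ^ 2 * (n : ℝ) ^ 2 ≤ 10 * N ^ 2 := by gcongr
    calc d n ^ 2 = 4 * (Real.pi ^ 2 * (n : ℝ) ^ 2) * c n ^ 2 := by simp only [hd]; ring
      _ ≤ 4 * (10 * N ^ 2) * c n ^ 2 := by gcongr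
      _ = _ := by ring
  set E := ∑ n ∈ Icc 1 N, c n ^ 2 with hE
  have hE0 : 0 ≤ E := sum_nonneg fun n _ => sq_nonneg _
  have h_deriv_int : δ / N * (2 * ∑ n ∈ Icc 1 N, d n ^ 2) ≤ 80 * δ * N * E := by
    calc δ / N * (2 * ∑ n ∈ Icc 1 N, d n ^ 2) ≤ δ / N * (2 * (40 * N ^ 2 * E)) := by gcongr
      _ = _ := by field_simp; ring
  have h_scaled : δ * ∑ i ∈ P, trigSq c N (α i) ≤ δ * (100 * (1 / δ + N) * E) := by
    have e : δ * (100 * (1 / δ + N) * E) = 100 * E + 100 * (δ * N * E) := by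
      field_simp
    have : 0 ≤ δ * N * E := by positivity
    rw [e]
    linarith
  exact le_of_mul_le_mul_left h_scaled hδ

/-- The large sieve inequality at the Farey fractions of order `D`. -/
theorem large_sieve_farey (c : ℕ → ℝ) {N : ℕ} (hN : 1 ≤ N) {D : ℕ} (hD : 1 ≤ D) :
    ∑ d ∈ Icc 1 D, ∑ b ∈ (Icc 1 d).filter (fun b => Nat.Coprime b d), trigSq c N ((b : ℝ) / d) ≤
      100 * ((D : ℝ) ^ 2 + N) * ∑ n ∈ Icc 1 N, c n ^ 2 := by
  have hD0 : (1 : ℝ) ≤ D := by exact_mod_cast hD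
  rw [sum_sigma' (Icc 1 D) (fun d => (Icc 1 d).filter (fun b => Nat.Coprime b d))
    (fun d b => trigSq c N ((b : ℝ) / d))]
  have := large_sieve ((Icc 1 D).sigma fun d => (Icc 1 d).filter (fun b => Nat.Coprime b d))
    (fun i => (i.2 : ℝ) / i.1) (δ := 1 / (D : ℝ) ^ 2) (by positivity)
    (by rw [div_le_one (by positivity)]; nlinarith) ?_ ?_ ?_ c hN
  · simpa using this
  · intro i _; positivity
  · rintro ⟨d, b⟩ hi
    simp only [mem_sigma, mem_Icc, mem_filter] at hi
    have : (0 : ℝ) < d := by exact_mod_cast hi.1.1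
    rw [div_le_one this]
    exact_mod_cast hi.2.1.2
  · rintro ⟨d, b⟩ hi ⟨d', b'⟩ hj hij
    simp only [mem_sigma, mem_Icc, mem_filter] at hi hj
    obtain ⟨⟨hd1, hdD⟩, ⟨hb1, hbd⟩, hcop⟩ := hi
    obtain ⟨⟨hd1', hdD'⟩, ⟨hb1', hbd'⟩, hcop'⟩ := hj
    have p1 : (0 : ℝ) < d := by exact_mod_cast hd1
    have p2 : (0 : ℝ) < d' := by exact_mod_cast hd1'
    have hne : b * d' ≠ b' * d := by
      intro h
      apply hij
      have hdd : d = d' := by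
        apply Nat.dvd_antisymm
        · exact hcop.symm.dvd_of_dvd_mul_left ⟨b', by rw [h]; ring⟩
        · exact hcop'.symm.dvd_of_dvd_mul_left ⟨b, by rw [← h]; ring⟩
      subst hdd
      have := Nat.eq_of_mul_eq_mul_right hd1 h
      subst this
      rfl
    have hz : (1 : ℝ) ≤ |(b : ℝ) * d' - b' * d| := by
      have h0 : ((b : ℤ) * d' - b' * d) ≠ 0 := by
        intro h; apply hne; zify; linarith
      exact_mod_cast Int.one_le_abs h0
    have e : (b : ℝ) / d - b' / d' = (b * d' - b' * d) / (d * d') := by field_simp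
    simp only
    rw [e, abs_div, abs_of_pos (mul_pos p1 p2)]
    have l1 : (d : ℝ) ≤ D := by exact_mod_cast hdD
    have l2 : (d' : ℝ) ≤ D := by exact_mod_cast hdD'
    refine div_le_div₀ (abs_nonneg _) hz (by positivity) ?_
    rw [sq]; gcongr

theorem sum_Icc_cos_mul_two_sin (θ : ℝ) (n : ℕ) :
    (∑ h ∈ Icc 1 n, Real.cos (h * θ)) * (2 * Real.sin (θ / 2)) =
      Real.sin (n * θ + θ / 2) - Real.sin (θ / 2) := by
  induction n with
  | zero => simp
  | succ n ih =>
    rw [sum_Icc_succ_top (by omega), add_mul, ih]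
    have e : (n : ℝ) * θ + θ / 2 = ((n + 1 : ℕ) : ℝ) * θ - θ / 2 := by push_cast; ring
    rw [e, Real.sin_add, Real.sin_sub]
    ring

theorem sum_cos_two_pi_mul_div {q : ℕ} (hq : 1 ≤ q) {k : ℤ} (hk : k ≠ 0) (hkq : |k| < q) :
    ∑ h ∈ Icc 1 q, Real.cos (2 * Real.pi * k * ((h : ℝ) / q)) = 0 := by
  have hq0 : (0 : ℝ) < q := by exact_mod_cast hq
  set θ : ℝ := 2 * Real.pi * k / q with hθ
  have h := sum_Icc_cos_mul_two_sin θ q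
  have e : (q : ℝ) * θ + θ / 2 = θ / 2 + k * (2 * Real.pi) := by
    rw [hθ]; field_simp; ring
  rw [e, Real.sin_add_int_mul_two_pi, sub_self] at h
  have hs : Real.sin (θ / 2) ≠ 0 := by
    rw [Ne, Real.sin_eq_zero_iff]
    rintro ⟨n, hn⟩
    have h1 : (n : ℝ) * q = k := by
      rw [hθ] at hn
      field_simp at hn
      linarith
    have h2 : n * (q : ℤ) = k := by exact_mod_cast h1
    have h3 : (q : ℤ) ∣ k := ⟨n, by rw [← h2]; ring⟩
    exact hk (Int.eq_zero_of_abs_lt_dvd h3 hkq)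
  have h4 := (mul_eq_zero.1 h).resolve_right (mul_ne_zero two_ne_zero hs)
  rw [← h4]
  refine sum_congr rfl fun h _ => ?_
  congr 1
  rw [hθ]; ring

theorem sum_trigSq_div (v : ℕ → ℝ) {q : ℕ} (hq : 1 ≤ q) :
    ∑ h ∈ Icc 1 q, trigSq v q ((h : ℝ) / q) = q * ∑ a ∈ Icc 1 q, v a ^ 2 := by
  simp only [trigSq_eq_sum_sum]
  rw [sum_comm, mul_sum]
  refine sum_congr rfl fun m hm => ?_
  rw [sum_comm, sum_eq_single m]
  · simp [sq]
  · intro n hn hnm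
    rw [← mul_sum]
    have hm' := mem_Icc.1 hm
    have hn' := mem_Icc.1 hn
    have := sum_cos_two_pi_mul_div hq (k := (m : ℤ) - n) (by omega) (by rw [abs_lt]; omega)
    push_cast at this
    rw [this, mul_zero]
  · intro h; exact absurd hm h

theorem sum_residues_mul (c φ : ℕ → ℝ) (N : ℕ) {q : ℕ} (hq : 1 ≤ q)
    (hφ : ∀ m n, m % q = n % q → φ m = φ n) :
    ∑ a ∈ Icc 1 q, (∑ n ∈ (Icc 1 N).filter (fun n => n % q = a % q), c n) * φ a =
      ∑ n ∈ Icc 1 N, c n * φ n := by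
  simp only [sum_filter, sum_mul]
  rw [sum_comm]
  refine sum_congr rfl fun n _ => ?_
  have hlt : n % q < q := Nat.mod_lt _ hq
  have hex : ∃ a ∈ Icc 1 q, n % q = a % q := by
    by_cases h : n % q = 0
    · exact ⟨q, mem_Icc.2 ⟨hq, le_rfl⟩, by simp [h]⟩
    · exact ⟨n % q, mem_Icc.2 ⟨by omega, hlt.le⟩, by simp⟩
  obtain ⟨a, ha, hna⟩ := hex
  rw [sum_eq_single a]
  · rw [if_pos hna, hφ n a hna]
  · intro b hb hba
    rw [if_neg, zero_mul]
    intro hnb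
    apply hba
    have ha' := mem_Icc.1 ha
    have hb' := mem_Icc.1 hb
    have hab : b % q = a % q := hnb.symm.trans hna
    rcases eq_or_lt_of_le ha'.2 with h1 | h1 <;> rcases eq_or_lt_of_le hb'.2 with h2 | h2
    · omega
    · rw [Nat.mod_eq_of_lt h2, h1, Nat.mod_self] at hab; omega
    · rw [Nat.mod_eq_of_lt h1, h2, Nat.mod_self] at hab; omega
    · rwa [Nat.mod_eq_of_lt h1, Nat.mod_eq_of_lt h2] at hab
  · intro h; exact absurd ha h

theorem exists_two_pi_mul_div_eq {m n q : ℕ} (hq : 1 ≤ q) (h : m % q = n % q) (b : ℕ) :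
    ∃ k : ℤ, 2 * Real.pi * m * ((b : ℝ) / q) =
      2 * Real.pi * n * ((b : ℝ) / q) + k * (2 * Real.pi) := by
  have hq0 : (q : ℝ) ≠ 0 := by positivity
  obtain ⟨l, hl⟩ := (Nat.modEq_iff_dvd.1 (show n ≡ m [MOD q] from h.symm))
  refine ⟨l * b, ?_⟩
  have hl' : (m : ℝ) - n = q * l := by exact_mod_cast hl
  have : (m : ℝ) = n + q * l := by linarith
  rw [this]; push_cast; field_simp

theorem trigSq_residues (c : ℕ → ℝ) (N : ℕ) {q : ℕ} (hq : 1 ≤ q) (b : ℕ) :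
    trigSq (fun a => ∑ n ∈ (Icc 1 N).filter (fun n => n % q = a % q), c n) q ((b : ℝ) / q) =
      trigSq c N ((b : ℝ) / q) := by
  unfold trigSq
  rw [sum_residues_mul c (fun n => Real.cos (2 * Real.pi * n * ((b : ℝ) / q))) N hq,
    sum_residues_mul c (fun n => Real.sin (2 * Real.pi * n * ((b : ℝ) / q))) N hq]
  · intro m n h
    obtain ⟨k, hk⟩ := exists_two_pi_mul_div_eq hq h b
    simp only [hk, Real.sin_add_int_mul_two_pi]
  · intro m n h
    obtain ⟨k, hk⟩ := exists_two_pi_mul_div_eq hq h b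
    simp only [hk, Real.cos_add_int_mul_two_pi]

theorem tendsto_trigSq {v : ℕ → ℕ → ℝ} {w : ℕ → ℝ} {q : ℕ}
    (h : ∀ a ∈ Icc 1 q, Filter.Tendsto (fun X => v X a) Filter.atTop (nhds (w a))) (t : ℝ) :
    Filter.Tendsto (fun X => trigSq (v X) q t) Filter.atTop (nhds (trigSq w q t)) := by
  unfold trigSq
  exact ((tendsto_finsetSum _ fun a ha => (h a ha).mul_const _).pow 2).add
    ((tendsto_finsetSum _ fun a ha => (h a ha).mul_const _).pow 2)

/-- Partial summation: bounds for `∑ T d` give bounds for `∑ T d / d`. -/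
theorem sum_Ioc_div_le {T : ℕ → ℝ} {K X : ℝ} (hK : 0 ≤ K) (hX : 0 ≤ X) {D : ℕ} (hD : 1 ≤ D)
    (hT : ∀ k, D ≤ k → ∑ d ∈ Ioc D k, T d ≤ K * ((k : ℝ) ^ 2 + X)) {y : ℕ} (hy : D ≤ y) :
    ∑ d ∈ Ioc D y, T d / d ≤ 2 * K * (y + X / D) := by
  have hD0 : (0 : ℝ) < D := by exact_mod_cast hD
  have key : ∑ d ∈ Ioc D y, T d / d ≤
      (∑ d ∈ Ioc D y, T d) / y + K * ((y : ℝ) - D) + K * X * (1 / D - 1 / y) := by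
    induction y, hy using Nat.le_induction with
    | base => simp
    | succ y hy ih =>
      have hy0 : (0 : ℝ) < y := by exact_mod_cast (lt_of_lt_of_le hD hy)
      have h1 := hT y hy
      set U := ∑ d ∈ Ioc D y, T d with hU
      rw [sum_Ioc_succ_top hy, sum_Ioc_succ_top hy, ← hU]
      push_cast
      have h2 : U / y - U / (y + 1) ≤ K + K * X * (1 / y - 1 / (y + 1)) := by
        have e1 : U / y - U / (y + 1) = U / (y * (y + 1)) := by field_simp; ring
        have e2 : K + K * X * (1 / y - 1 / (y + 1)) =
            (K * (y * (y + 1)) + K * X) / (y * (y + 1)) := by field_simp; ring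
        rw [e1, e2]
        gcongr
        nlinarith [mul_nonneg hK hy0.le]
      rw [add_div]
      have e3 : K * X * (1 / D - 1 / (y + 1)) =
        K * X * (1 / D - 1 / y) + K * X * (1 / y - 1 / (y + 1)) := by ring
      rw [e3]
      linarith
  have hy0 : (0 : ℝ) < y := by exact_mod_cast (lt_of_lt_of_le hD hy)
  have h1 : (∑ d ∈ Ioc D y, T d) / y ≤ K * y + K * X * (1 / y) := by
    have := hT y hy
    rw [div_le_iff₀ hy0]
    calc _ ≤ _ := this
      _ = _ := by field_simp
  have h2 : 0 ≤ K * X * (1 / D) := by positivity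
  have h3 : 0 ≤ K * D := by positivity
  have e : 2 * K * (y + X / D) = 2 * (K * y) + 2 * (K * X * (1 / D)) := by ring
  rw [e]
  linarith

/-- Sorting the fractions `h / q` according to their reduced form. -/
theorem sum_reduced_fractions {W : ℕ → ℕ → ℝ}
    (hW : ∀ g d b, 1 ≤ g → 1 ≤ d → W (d * g) (b * g) = W d b) (N : ℕ) :
    ∑ q ∈ Icc 1 N, (1 / (q : ℝ)) * ∑ h ∈ Icc 1 q, W q h =
      ∑ m ∈ Icc 1 N, (1 / (m : ℝ)) * ∑ d ∈ Icc 1 (N / m),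
        (∑ b ∈ (Icc 1 d).filter (fun b => Nat.Coprime b d), W d b) / d := by
  simp only [mul_sum, sum_div]
  simp only [sum_sigma']
  refine sum_bij' (fun i _ => ⟨Nat.gcd i.2 i.1, i.1 / Nat.gcd i.2 i.1, i.2 / Nat.gcd i.2 i.1⟩)
    (fun j _ => ⟨j.2.1 * j.1, j.2.2 * j.1⟩) ?_ ?_ ?_ ?_ ?_
  · rintro ⟨q, h⟩ hi
    simp only [mem_sigma, mem_Icc, mem_filter] at hi ⊢
    obtain ⟨⟨hq, hqN⟩, hh, hhq⟩ := hi
    have hg : 0 < Nat.gcd h q := Nat.gcd_pos_of_pos_left _ hh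
    have hgq : Nat.gcd h q ≤ q := Nat.gcd_le_right _ hq
    have hgh : Nat.gcd h q ≤ h := Nat.gcd_le_left _ hh
    exact ⟨⟨hg, hgq.trans hqN⟩, ⟨Nat.div_pos hgq hg, Nat.div_le_div_right hqN⟩,
      ⟨Nat.div_pos hgh hg, Nat.div_le_div_right hhq⟩, Nat.coprime_div_gcd_div_gcd hg⟩
  · rintro ⟨m, d, b⟩ hj
    simp only [mem_sigma, mem_Icc, mem_filter] at hj ⊢
    obtain ⟨⟨hm, hmN⟩, ⟨hd, hdN⟩, ⟨hb, hbd⟩, hc⟩ := hj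
    exact ⟨⟨Nat.mul_pos hd hm, (Nat.le_div_iff_mul_le hm).1 hdN⟩, Nat.mul_pos hb hm,
      Nat.mul_le_mul_right _ hbd⟩
  · rintro ⟨q, h⟩ hi
    simp only [Nat.div_mul_cancel (Nat.gcd_dvd_right h q),
      Nat.div_mul_cancel (Nat.gcd_dvd_left h q)]
  · rintro ⟨m, d, b⟩ hj
    simp only [mem_sigma, mem_Icc, mem_filter] at hj
    obtain ⟨⟨hm, hmN⟩, ⟨hd, hdN⟩, ⟨hb, hbd⟩, hc⟩ := hj
    have hg : Nat.gcd (b * m) (d * m) = m := by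
      rw [Nat.gcd_mul_right, Nat.Coprime.gcd_eq_one hc, one_mul]
    simp only [hg, Nat.mul_div_cancel _ hm]
  · rintro ⟨q, h⟩ hi
    simp only [mem_sigma, mem_Icc] at hi
    obtain ⟨⟨hq, hqN⟩, hh, hhq⟩ := hi
    have hg : 0 < Nat.gcd h q := Nat.gcd_pos_of_pos_left _ hh
    have hgq : Nat.gcd h q ≤ q := Nat.gcd_le_right _ hq
    have e := hW (Nat.gcd h q) (q / Nat.gcd h q) (h / Nat.gcd h q) hg (Nat.div_pos hgq hg)
    rw [Nat.div_mul_cancel (Nat.gcd_dvd_right h q), Nat.div_mul_cancel (Nat.gcd_dvd_left h q)] at e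
    have e2 : (q : ℝ) = ((q / Nat.gcd h q : ℕ) : ℝ) * (Nat.gcd h q : ℕ) := by
      exact_mod_cast (Nat.div_mul_cancel (Nat.gcd_dvd_right h q)).symm
    simp only
    rw [e]
    nth_rewrite 1 [e2]
    rw [one_div, mul_inv]
    ring

theorem sum_Icc_one_div_sq_le (N : ℕ) : ∑ m ∈ Icc 1 N, 1 / (m : ℝ) ^ 2 ≤ 2 := by
  have h : ∀ n : ℕ, ∑ m ∈ Icc 1 (n + 1), 1 / (m : ℝ) ^ 2 ≤ 2 - 1 / ((n : ℝ) + 1) := by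
    intro n
    induction n with
    | zero => norm_num
    | succ n ih =>
      rw [sum_Icc_succ_top (by omega)]
      push_cast
      have : 1 / ((n : ℝ) + 1 + 1) ^ 2 ≤ 1 / ((n : ℝ) + 1) - 1 / ((n : ℝ) + 1 + 1) := by
        rw [div_sub_div _ _ (by positivity) (by positivity),
          div_le_div_iff₀ (by positivity) (by positivity)]
        nlinarith [(Nat.cast_nonneg n : (0 : ℝ) ≤ n)]
      linarith
  rcases N with _ | n
  · simp
  · have := h n
    have h2 : 0 ≤ 1 / ((n : ℝ) + 1) := by positivity
    linarith

theorem sum_Icc_one_div_le (N : ℕ) : ∑ m ∈ Icc 1 N, 1 / (m : ℝ) ≤ 1 + Real.log N := by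
  have := harmonic_le_one_add_log N
  rw [harmonic_eq_sum_Icc] at this
  push_cast at this
  simpa using this

theorem Scount_eq_sum_indicator (S : Set ℕ) (x : ℝ) (q a : ℕ) :
    Scount S x q a =
      ∑ n ∈ (Icc 1 ⌊x⌋₊).filter (fun n => n % q = a % q), S.indicator (fun _ => (1 : ℝ)) n := by
  rw [Scount, ← filter_filter, card_eq_sum_ones, sum_filter]
  push_cast
  rfl

theorem sum_indicator_sq_le (S : Set ℕ) (N : ℕ) :
    ∑ n ∈ Icc 1 N, S.indicator (fun _ => (1 : ℝ)) n ^ 2 ≤ N := by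
  calc ∑ n ∈ Icc 1 N, S.indicator (fun _ => (1 : ℝ)) n ^ 2 ≤ ∑ n ∈ Icc 1 N, (1 : ℝ) :=
        sum_le_sum fun n _ => by by_cases h : n ∈ S <;> simp [h]
    _ = N := by simp

/-- The coefficients `1_S(n) (1_{n ≤ x} - x / X)`, whose residue class sums approximate
`S(x;q,a) - f(q, gcd(q,a)) x` as `X → ∞`. -/
noncomputable def balancedCoeff (S : Set ℕ) (x : ℝ) (X n : ℕ) : ℝ :=
  (if n ≤ ⌊x⌋₊ then S.indicator (fun _ => (1 : ℝ)) n else 0) -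
    x / X * S.indicator (fun _ => (1 : ℝ)) n

theorem sum_ite_le_eq {M X : ℕ} (h : M ≤ X) (g : ℕ → ℝ) :
    ∑ n ∈ Icc 1 X, (if n ≤ M then g n else 0) = ∑ n ∈ Icc 1 M, g n := by
  rw [← sum_filter]
  refine sum_congr ?_ fun _ _ => rfl
  ext n
  simp only [mem_filter, mem_Icc]
  omega

theorem sum_balancedCoeff_mul (S : Set ℕ) {x : ℝ} {X : ℕ} (hX : ⌊x⌋₊ ≤ X) (φ : ℕ → ℝ) :
    ∑ n ∈ Icc 1 X, balancedCoeff S x X n * φ n =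
      ∑ n ∈ Icc 1 ⌊x⌋₊, S.indicator (fun _ => (1 : ℝ)) n * φ n -
        x / X * ∑ n ∈ Icc 1 X, S.indicator (fun _ => (1 : ℝ)) n * φ n := by
  rw [← sum_ite_le_eq hX, mul_sum, ← sum_sub_distrib]
  refine sum_congr rfl fun n _ => ?_
  unfold balancedCoeff
  split_ifs <;> ring

theorem sum_residues_balancedCoeff (S : Set ℕ) {x : ℝ} {X : ℕ} (hX : ⌊x⌋₊ ≤ X) (q a : ℕ) :
    ∑ n ∈ (Icc 1 X).filter (fun n => n % q = a % q), balancedCoeff S x X n =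
      Scount S x q a - x * (Scount S X q a / X) := by
  have h := sum_balancedCoeff_mul S hX (fun n => if n % q = a % q then 1 else 0)
  simp only [mul_ite, mul_one, mul_zero, ← sum_filter] at h
  rw [h, Scount_eq_sum_indicator, Scount_eq_sum_indicator, Nat.floor_natCast]
  ring

theorem trigSq_balancedCoeff_le (S : Set ℕ) {x : ℝ} {X : ℕ} (hX : ⌊x⌋₊ ≤ X) (t : ℝ) :
    trigSq (balancedCoeff S x X) X t ≤
      2 * trigSq (S.indicator fun _ => (1 : ℝ)) ⌊x⌋₊ t +
        2 * (x / X) ^ 2 * trigSq (S.indicator fun _ => (1 : ℝ)) X t := by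
  unfold trigSq
  rw [sum_balancedCoeff_mul S hX (fun n => Real.cos (2 * Real.pi * n * t)),
    sum_balancedCoeff_mul S hX (fun n => Real.sin (2 * Real.pi * n * t))]
  have key : ∀ p r y : ℝ, (p - r * y) ^ 2 ≤ 2 * p ^ 2 + 2 * r ^ 2 * y ^ 2 := by
    intro p r y
    nlinarith [sq_nonneg (p + r * y)]
  refine (add_le_add (key _ _ _) (key _ _ _)).trans (le_of_eq ?_)
  ring

section Discrepancy

variable {S : Set ℕ} {f : ℕ → ℕ → ℝ}

theorem tendsto_trigSq_balancedCoeff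
    (hT : ∀ q a : ℕ, 1 ≤ q → 1 ≤ a → a ≤ q →
      Filter.Tendsto (fun X : ℕ => Scount S X q a / X) Filter.atTop (nhds (f q (Nat.gcd q a))))
    (x : ℝ) {q : ℕ} (hq : 1 ≤ q) (h : ℕ) :
    Filter.Tendsto (fun X => trigSq (balancedCoeff S x X) X ((h : ℝ) / q)) Filter.atTop
      (nhds (trigSq (fun a => Scount S x q a - f q (Nat.gcd q a) * x) q ((h : ℝ) / q))) := by
  have key := tendsto_trigSq (q := q) (v := fun X a => Scount S x q a - x * (Scount S X q a / X))
    (w := fun a => Scount S x q a - f q (Nat.gcd q a) * x) (fun a ha => by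
      have := (hT q a hq (mem_Icc.1 ha).1 (mem_Icc.1 ha).2).const_mul x
      rw [mul_comm x] at this
      exact this.const_sub _) ((h : ℝ) / q)
  refine key.congr' ?_
  filter_upwards [Filter.eventually_ge_atTop ⌊x⌋₊] with X hX
  rw [← trigSq_residues (balancedCoeff S x X) X hq]
  simp only [sum_residues_balancedCoeff S hX]

theorem trigSq_discrepancy_mul
    (hT : ∀ q a : ℕ, 1 ≤ q → 1 ≤ a → a ≤ q →
      Filter.Tendsto (fun X : ℕ => Scount S X q a / X) Filter.atTop (nhds (f q (Nat.gcd q a))))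
    (x : ℝ) {g d : ℕ} (b : ℕ) (hg : 1 ≤ g) (hd : 1 ≤ d) :
    trigSq (fun a => Scount S x (d * g) a - f (d * g) (Nat.gcd (d * g) a) * x) (d * g)
        (((b * g : ℕ) : ℝ) / (d * g : ℕ)) =
      trigSq (fun a => Scount S x d a - f d (Nat.gcd d a) * x) d ((b : ℝ) / d) := by
  have h1 := tendsto_trigSq_balancedCoeff hT x (Nat.mul_pos hd hg) (b * g)
  have h2 := tendsto_trigSq_balancedCoeff hT x hd b
  have e : ((b * g : ℕ) : ℝ) / (d * g : ℕ) = (b : ℝ) / d := by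
    have : (g : ℝ) ≠ 0 := by positivity
    push_cast
    rw [mul_div_mul_right _ _ this]
  rw [e] at h1 ⊢
  exact tendsto_nhds_unique h1 h2

theorem sum_farey_trigSq_discrepancy_le
    (hT : ∀ q a : ℕ, 1 ≤ q → 1 ≤ a → a ≤ q →
      Filter.Tendsto (fun X : ℕ => Scount S X q a / X) Filter.atTop (nhds (f q (Nat.gcd q a))))
    {x : ℝ} (hx : 1 ≤ x) {D : ℕ} (hD : 1 ≤ D) :
    ∑ d ∈ Icc 1 D, ∑ b ∈ (Icc 1 d).filter (fun b => Nat.Coprime b d),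
        trigSq (fun a => Scount S x d a - f d (Nat.gcd d a) * x) d ((b : ℝ) / d) ≤
      400 * x * ((D : ℝ) ^ 2 + x) := by
  set ind : ℕ → ℝ := S.indicator fun _ => (1 : ℝ) with hind
  have hx0 : 0 < x := by linarith
  have hM : 1 ≤ ⌊x⌋₊ := Nat.le_floor (by simpa using hx)
  have hMx : (⌊x⌋₊ : ℝ) ≤ x := Nat.floor_le hx0.le
  have hls : ∀ N : ℕ, 1 ≤ N → ∑ d ∈ Icc 1 D, ∑ b ∈ (Icc 1 d).filter (fun b => Nat.Coprime b d),
      trigSq ind N ((b : ℝ) / d) ≤ 100 * ((D : ℝ) ^ 2 + N) * N := fun N hN =>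
    (large_sieve_farey ind hN hD).trans
      (mul_le_mul_of_nonneg_left (sum_indicator_sq_le S N) (by positivity))
  have lim1 : Filter.Tendsto (fun X : ℕ => ∑ d ∈ Icc 1 D,
      ∑ b ∈ (Icc 1 d).filter (fun b => Nat.Coprime b d),
        trigSq (balancedCoeff S x X) X ((b : ℝ) / d)) Filter.atTop
      (nhds (∑ d ∈ Icc 1 D, ∑ b ∈ (Icc 1 d).filter (fun b => Nat.Coprime b d),
        trigSq (fun a => Scount S x d a - f d (Nat.gcd d a) * x) d ((b : ℝ) / d))) :=
    tendsto_finsetSum _ fun d hd => tendsto_finsetSum _ fun b _ =>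
      tendsto_trigSq_balancedCoeff hT x (mem_Icc.1 hd).1 b
  have lim2 : Filter.Tendsto (fun X : ℕ => 200 * x * ((D : ℝ) ^ 2 + x) +
      200 * x ^ 2 * ((D : ℝ) ^ 2 / X + 1)) Filter.atTop
      (nhds (200 * x * ((D : ℝ) ^ 2 + x) + 200 * x ^ 2 * (0 + 1))) :=
    (((tendsto_const_div_atTop_nhds_zero_nat _).add_const _).const_mul _).const_add _
  have hlim := le_of_tendsto_of_tendsto lim1 lim2 ?_
  · refine hlim.trans ?_
    have : 0 ≤ x * (D : ℝ) ^ 2 := by positivity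
    nlinarith
  · filter_upwards [Filter.eventually_ge_atTop ⌊x⌋₊] with X hX
    have hX1 : 1 ≤ X := hM.trans hX
    have hX0 : (0 : ℝ) < X := by exact_mod_cast hX1
    calc ∑ d ∈ Icc 1 D, ∑ b ∈ (Icc 1 d).filter (fun b => Nat.Coprime b d),
          trigSq (balancedCoeff S x X) X ((b : ℝ) / d)
        ≤ ∑ d ∈ Icc 1 D, ∑ b ∈ (Icc 1 d).filter (fun b => Nat.Coprime b d),
          (2 * trigSq ind ⌊x⌋₊ ((b : ℝ) / d) + 2 * (x / X) ^ 2 * trigSq ind X ((b : ℝ) / d)) :=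
          sum_le_sum fun d _ => sum_le_sum fun b _ => trigSq_balancedCoeff_le S hX _
      _ = 2 * ∑ d ∈ Icc 1 D, ∑ b ∈ (Icc 1 d).filter (fun b => Nat.Coprime b d),
            trigSq ind ⌊x⌋₊ ((b : ℝ) / d) +
          2 * (x / X) ^ 2 * ∑ d ∈ Icc 1 D, ∑ b ∈ (Icc 1 d).filter (fun b => Nat.Coprime b d),
            trigSq ind X ((b : ℝ) / d) := by
          simp only [sum_add_distrib, mul_sum]
      _ ≤ 2 * (100 * ((D : ℝ) ^ 2 + x) * x) +
          2 * (x / X) ^ 2 * (100 * ((D : ℝ) ^ 2 + X) * X) := by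
          have b1 := hls _ hM
          have b2 := hls _ hX1
          have b3 : 100 * ((D : ℝ) ^ 2 + ⌊x⌋₊) * ⌊x⌋₊ ≤ 100 * ((D : ℝ) ^ 2 + x) * x := by gcongr
          have b4 := b1.trans b3
          gcongr
      _ = _ := by field_simp; ring

/-- The variance bound in terms of a pointwise bound `B` for the discrepancies of moduli up to a
cut-off `D`. -/
theorem sum_sq_discrepancy_le
    (hT : ∀ q a : ℕ, 1 ≤ q → 1 ≤ a → a ≤ q →
      Filter.Tendsto (fun X : ℕ => Scount S X q a / X) Filter.atTop (nhds (f q (Nat.gcd q a))))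
    {x B : ℝ} (hx : 1 ≤ x) (hB : ∀ q a : ℕ, 1 ≤ q → 1 ≤ a → a ≤ q →
      |Scount S x q a - f q (Nat.gcd q a) * x| ≤ B)
    {D : ℕ} (hD : 1 ≤ D) (N : ℕ) :
    ∑ q ∈ Icc 1 N, ∑ a ∈ Icc 1 q, (Scount S x q a - f q (Nat.gcd q a) * x) ^ 2 ≤
      1600 * x * N + (1 + Real.log N) * ((D : ℝ) ^ 2 * B ^ 2 + 800 * x ^ 2 / D) := by
  have hD0 : (0 : ℝ) < D := by exact_mod_cast hD
  set v : ℕ → ℕ → ℝ := fun q a => Scount S x q a - f q (Nat.gcd q a) * x with hv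
  set W : ℕ → ℕ → ℝ := fun q h => trigSq (v q) q ((h : ℝ) / q) with hW
  have hW0 : ∀ q h, 0 ≤ W q h := fun q h => trigSq_nonneg _ _ _
  set T : ℕ → ℝ := fun d => ∑ b ∈ (Icc 1 d).filter (fun b => Nat.Coprime b d), W d b with hTd
  have hT0 : ∀ d, 0 ≤ T d := fun d => sum_nonneg fun b _ => hW0 d b
  have hP : ∀ q, 1 ≤ q → ∑ a ∈ Icc 1 q, v q a ^ 2 = (1 / (q : ℝ)) * ∑ h ∈ Icc 1 q, W q h := by
    intro q hq
    have hq0 : (0 : ℝ) < q := by exact_mod_cast hq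
    rw [hW, sum_trigSq_div (v q) hq]
    field_simp
  have e1 : ∑ q ∈ Icc 1 N, ∑ a ∈ Icc 1 q, v q a ^ 2 =
      ∑ m ∈ Icc 1 N, (1 / (m : ℝ)) * ∑ d ∈ Icc 1 (N / m), T d / d := by
    rw [sum_congr rfl fun q hq => hP q (mem_Icc.1 hq).1]
    exact sum_reduced_fractions
      (fun g d b hg hd => trigSq_discrepancy_mul hT x b hg hd) N
  have small : ∑ d ∈ Icc 1 D, T d / d ≤ (D : ℝ) ^ 2 * B ^ 2 := by
    calc ∑ d ∈ Icc 1 D, T d / d ≤ ∑ d ∈ Icc 1 D, (D : ℝ) * B ^ 2 := by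
          refine sum_le_sum fun d hd => ?_
          have hd' := mem_Icc.1 hd
          have hdD : (d : ℝ) ≤ D := by exact_mod_cast hd'.2
          have t1 : T d ≤ ∑ h ∈ Icc 1 d, W d h :=
            sum_le_sum_of_subset_of_nonneg (filter_subset _ _) fun b _ _ => hW0 d b
          calc T d / d ≤ (∑ h ∈ Icc 1 d, W d h) / d := by gcongr
            _ = ∑ a ∈ Icc 1 d, v d a ^ 2 := by rw [hP d hd'.1]; ring
            _ ≤ ∑ a ∈ Icc 1 d, B ^ 2 := by
                refine sum_le_sum fun a ha => ?_
                exact sq_le_sq.2 ((hB d a hd'.1 (mem_Icc.1 ha).1 (mem_Icc.1 ha).2).trans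
                  (le_abs_self B))
            _ = d * B ^ 2 := by simp
            _ ≤ D * B ^ 2 := by gcongr
      _ = _ := by simp; ring
  have large : ∀ y : ℕ, ∑ d ∈ Ioc D y, T d / d ≤ 800 * x * (y + x / D) := by
    intro y
    rcases le_total D y with hy | hy
    · have := sum_Ioc_div_le (T := T) (K := 400 * x) (X := x) (by positivity) (by positivity) hD
        (fun k hk => ?_) hy
      · refine this.trans (le_of_eq ?_); ring
      · refine le_trans ?_ (sum_farey_trigSq_discrepancy_le hT hx (hD.trans hk))
        refine sum_le_sum_of_subset_of_nonneg ?_ fun d _ _ => hT0 d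
        intro d hd
        rw [mem_Ioc] at hd
        exact mem_Icc.2 ⟨by omega, hd.2⟩
    · rw [Ioc_eq_empty (by omega), sum_empty]
      positivity
  have total : ∀ y : ℕ, ∑ d ∈ Icc 1 y, T d / d ≤
      (D : ℝ) ^ 2 * B ^ 2 + 800 * x * (y + x / D) := by
    intro y
    have hsub : Icc 1 y ⊆ Icc 1 D ∪ Ioc D y := by
      intro d hd
      simp only [mem_union, mem_Icc, mem_Ioc] at hd ⊢
      omega
    have hnn : ∀ d, 0 ≤ T d / d := fun d => div_nonneg (hT0 d) (Nat.cast_nonneg d)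
    refine (sum_le_sum_of_subset_of_nonneg hsub fun d _ _ => hnn d).trans ?_
    rw [sum_union]
    · exact add_le_add small (large y)
    · refine disjoint_left.2 fun d h1 h2 => ?_
      rw [mem_Icc] at h1; rw [mem_Ioc] at h2; omega
  rw [e1]
  set G : ℝ := (D : ℝ) ^ 2 * B ^ 2 + 800 * x ^ 2 / D with hG
  have hG0 : 0 ≤ G := by positivity
  calc ∑ m ∈ Icc 1 N, (1 / (m : ℝ)) * ∑ d ∈ Icc 1 (N / m), T d / d
      ≤ ∑ m ∈ Icc 1 N, (800 * x * N * (1 / (m : ℝ) ^ 2) + 1 / (m : ℝ) * G) := by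
        refine sum_le_sum fun m hm => ?_
        have hm0 : (0 : ℝ) < m := by exact_mod_cast (mem_Icc.1 hm).1
        have hdiv : ((N / m : ℕ) : ℝ) ≤ N / m := Nat.cast_div_le
        calc (1 / (m : ℝ)) * ∑ d ∈ Icc 1 (N / m), T d / d
            ≤ (1 / (m : ℝ)) * ((D : ℝ) ^ 2 * B ^ 2 + 800 * x * ((N / m : ℕ) + x / D)) := by
              gcongr; exact total _
          _ ≤ (1 / (m : ℝ)) * ((D : ℝ) ^ 2 * B ^ 2 + 800 * x * ((N : ℝ) / m + x / D)) := by
              gcongr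
          _ = _ := by rw [hG]; field_simp; ring
    _ = 800 * x * N * ∑ m ∈ Icc 1 N, 1 / (m : ℝ) ^ 2 + (∑ m ∈ Icc 1 N, 1 / (m : ℝ)) * G := by
        rw [sum_add_distrib, mul_sum, sum_mul]
    _ ≤ 800 * x * N * 2 + (1 + Real.log N) * G := by
        have h1 := sum_Icc_one_div_sq_le N
        have h2 := sum_Icc_one_div_le N
        gcongr
    _ = _ := by ring

theorem tendsto_Scount_div
    (hU : ∃ C : ℝ, ∀ x : ℝ, 2 ≤ x → ∀ q a : ℕ, 1 ≤ q → 1 ≤ a → a ≤ q →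
      |Scount S x q a - f q (Nat.gcd q a) * x| ≤ C * x * Real.log x ^ (-1 : ℝ))
    {q a : ℕ} (hq : 1 ≤ q) (ha : 1 ≤ a) (haq : a ≤ q) :
    Filter.Tendsto (fun X : ℕ => Scount S X q a / X) Filter.atTop
      (nhds (f q (Nat.gcd q a))) := by
  obtain ⟨C, hC⟩ := hU
  rw [tendsto_iff_norm_sub_tendsto_zero]
  have hlog : Filter.Tendsto (fun X : ℕ => C * Real.log X ^ (-1 : ℝ)) Filter.atTop (nhds 0) := by
    have := ((tendsto_rpow_neg_atTop one_pos).comp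
      (Real.tendsto_log_atTop.comp tendsto_natCast_atTop_atTop)).const_mul C
    simpa using this
  refine squeeze_zero' (Filter.Eventually.of_forall fun _ => norm_nonneg _) ?_ hlog
  filter_upwards [Filter.eventually_ge_atTop 2] with X hX
  have hX2 : (2 : ℝ) ≤ X := by exact_mod_cast hX
  have hX0 : (0 : ℝ) < X := by linarith
  have e : Scount S X q a / X - f q (Nat.gcd q a) =
      (Scount S X q a - f q (Nat.gcd q a) * X) / X := by field_simp
  rw [e, Real.norm_eq_abs, abs_div, abs_of_pos hX0, div_le_iff₀ hX0]
  refine (hC X hX2 q a hq ha haq).trans (le_of_eq ?_)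
  ring

end Discrepancy

/-- Hooley III: if S satisfies Criterion U with main term f(q, gcd(q,a)) x, then
the Barban–Davenport–Halberstam variance is ≪ Qx + x²(log x)^{-A}. -/
theorem hooleyIII_criterionU (S : Set ℕ) (f : ℕ → ℕ → ℝ)
    (hU : ∀ A : ℝ, 0 < A → ∃ CA : ℝ, 0 < CA ∧
      ∀ x : ℝ, 2 ≤ x → ∀ q a : ℕ, 1 ≤ q → 1 ≤ a → a ≤ q →
        |Scount S x q a - f q (Nat.gcd q a) * x| ≤ CA * x * Real.log x ^ (-A)) :
    ∀ A : ℝ, 0 < A → ∃ C : ℝ, 0 < C ∧ ∀ x Q : ℝ, 2 ≤ x → 1 ≤ Q → Q ≤ x →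
      ∑ q ∈ Finset.Icc 1 ⌊Q⌋₊, ∑ a ∈ Finset.Icc 1 q,
          (Scount S x q a - f q (Nat.gcd q a) * x) ^ 2 ≤
        C * (Q * x + x ^ 2 * Real.log x ^ (-A)) := by
  intro A hA
  have hT : ∀ q a : ℕ, 1 ≤ q → 1 ≤ a → a ≤ q →
      Filter.Tendsto (fun X : ℕ => Scount S X q a / X) Filter.atTop
        (nhds (f q (Nat.gcd q a))) := fun q a hq ha haq =>
    tendsto_Scount_div ((hU 1 one_pos).imp fun C h => h.2) hq ha haq
  obtain ⟨K, hK, hKU⟩ := hU (3 * (A + 1) / 2) (by positivity)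
  have hl2 : 0 < Real.log 2 := Real.log_pos (by norm_num)
  set κ : ℝ := 1 + Real.log 2 ^ (-(A + 1)) with hκ
  have hκ0 : 0 < κ := by positivity
  refine ⟨1600 + 3 * (κ ^ 2 * K ^ 2 + 800), by positivity, ?_⟩
  intro x Q hx hQ hQx
  have hx0 : 0 < x := by linarith
  set L := Real.log x with hL
  have hl2L : Real.log 2 ≤ L := Real.log_le_log (by norm_num) hx
  have hL0 : 0 < L := hl2.trans_le hl2L
  set P : ℝ := L ^ (A + 1) with hP
  have hP0 : 0 < P := by positivity
  set D : ℕ := ⌊P⌋₊ + 1 with hD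
  have hPD : P ≤ D := by
    have := (Nat.lt_floor_add_one P).le
    simpa [hD] using this
  have hD0 : (0 : ℝ) < D := hP0.trans_le hPD
  have hDP : (D : ℝ) ≤ κ * P := by
    have h1 : (D : ℝ) ≤ P + 1 := by
      have := Nat.floor_le hP0.le
      rw [hD]; push_cast; linarith
    have h2 : Real.log 2 ^ (A + 1) ≤ P := Real.rpow_le_rpow hl2.le hl2L (by linarith)
    have h3 : 1 ≤ Real.log 2 ^ (-(A + 1)) * P := by
      calc (1 : ℝ) = Real.log 2 ^ (-(A + 1)) * Real.log 2 ^ (A + 1) := by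
            rw [← Real.rpow_add hl2]; simp
        _ ≤ _ := by gcongr
    rw [hκ, add_mul, one_mul]
    linarith
  have main := sum_sq_discrepancy_le hT (by linarith : (1 : ℝ) ≤ x) (hKU x hx)
    (D := D) (by omega) ⌊Q⌋₊
  refine main.trans ?_
  have hNQ : (⌊Q⌋₊ : ℝ) ≤ Q := Nat.floor_le (by linarith)
  have hN1 : (1 : ℝ) ≤ ⌊Q⌋₊ := by exact_mod_cast Nat.le_floor (by simpa using hQ)
  have hlogN : 1 + Real.log ⌊Q⌋₊ ≤ 3 * L := by
    have h1 : Real.log ⌊Q⌋₊ ≤ L := Real.log_le_log (by linarith) (hNQ.trans hQx)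
    have h2 := Real.log_two_gt_d9
    linarith
  set E : ℝ := L ^ (-A) with hE
  have hE0 : 0 < E := by positivity
  have r1 : L * P⁻¹ = E := by
    rw [hP, ← Real.rpow_neg hL0.le]
    nth_rewrite 1 [← Real.rpow_one L]
    rw [← Real.rpow_add hL0, hE]
    congr 1; ring
  have r2 : (L ^ (-(3 * (A + 1) / 2))) ^ 2 = (P⁻¹) ^ 3 := by
    rw [hP, ← Real.rpow_neg hL0.le, ← Real.rpow_natCast, ← Real.rpow_natCast, ← Real.rpow_mul hL0.le,
      ← Real.rpow_mul hL0.le]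
    congr 1; push_cast; ring
  have s1 : (D : ℝ) ^ 2 * (K * x * L ^ (-(3 * (A + 1) / 2))) ^ 2 ≤ κ ^ 2 * K ^ 2 * x ^ 2 * P⁻¹ := by
    calc (D : ℝ) ^ 2 * (K * x * L ^ (-(3 * (A + 1) / 2))) ^ 2
        ≤ (κ * P) ^ 2 * (K * x * L ^ (-(3 * (A + 1) / 2))) ^ 2 := by gcongr
      _ = κ ^ 2 * K ^ 2 * x ^ 2 * (P ^ 2 * (L ^ (-(3 * (A + 1) / 2))) ^ 2) := by ring
      _ = _ := by rw [r2]; field_simp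
  have s2 : 800 * x ^ 2 / D ≤ 800 * x ^ 2 * P⁻¹ := by
    rw [← div_eq_mul_inv]; gcongr
  calc 1600 * x * ⌊Q⌋₊ + (1 + Real.log ⌊Q⌋₊) *
        ((D : ℝ) ^ 2 * (K * x * L ^ (-(3 * (A + 1) / 2))) ^ 2 + 800 * x ^ 2 / D)
      ≤ 1600 * x * Q + 3 * L * (κ ^ 2 * K ^ 2 * x ^ 2 * P⁻¹ + 800 * x ^ 2 * P⁻¹) := by
        gcongr
    _ = 1600 * (Q * x) + 3 * (κ ^ 2 * K ^ 2 + 800) * (x ^ 2 * (L * P⁻¹)) := by ring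
    _ = 1600 * (Q * x) + 3 * (κ ^ 2 * K ^ 2 + 800) * (x ^ 2 * E) := by rw [r1]
    _ ≤ _ := by
        have h1 : 0 ≤ Q * x := by positivity
        have h2 : 0 ≤ x ^ 2 * E := by positivity
        have h3 : 0 ≤ 3 * (κ ^ 2 * K ^ 2 + 800) * (Q * x) := by positivity
        linarith
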